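/- arXiv:2509.22194 — 3 statements merged into one kernel-verified Lean document; each statement's English description precedes it below -/
import Mathlib

section
/- Let g_1,…,g_k : ℝ^n → ℝ be convex functions, let X := {x ∈ ℝ^n : g_i(x) ≤ 0 for all i = 1,…,k} be nonempty with diameter at most A (in the ℓ∞ norm), and suppose there exist ρ > 0 and x̄ ∈ X with g_i(x̄) ≤ −ρ for all i. Then for every y ∈ ℝ^n, dist(y, X) ≤ (A/ρ) · max_{1≤i≤k} max{g_i(y), 0}. -/
/-- **Hoffman-type error bound under a Slater condition.**
Let `g_1, …, g_k : ℝ^n → ℝ` (with the ℓ∞ norm on `ℝ^n = Fin n → ℝ`) be convex,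
let `X = {x : ∀ i, g i x ≤ 0}` be nonempty with diameter at most `A`, and suppose
there are `ρ > 0` and `xbar ∈ X` with `g i xbar ≤ -ρ` for all `i`.  Then for every `y`,
`dist(y, X) ≤ (A/ρ) · max_i max{g i y, 0}`. -/
theorem slater_distance_bound {n k : ℕ} (hk : 0 < k)
    (g : Fin k → (Fin n → ℝ) → ℝ)
    (hconv : ∀ i, ConvexOn ℝ Set.univ (g i))
    (X : Set (Fin n → ℝ)) (hX : X = {x | ∀ i, g i x ≤ 0})
    (hne : X.Nonempty)
    (A : ℝ) (hdiam : ∀ x ∈ X, ∀ y ∈ X, ‖x - y‖ ≤ A)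
    (ρ : ℝ) (hρ : 0 < ρ)
    (xbar : Fin n → ℝ) (hxbarX : xbar ∈ X) (hslater : ∀ i, g i xbar ≤ -ρ) :
    ∀ y : Fin n → ℝ,
      Metric.infDist y X ≤
        (A / ρ) * (Finset.univ.sup' (Finset.univ_nonempty_iff.mpr ⟨⟨0, hk⟩⟩)
          fun i => max (g i y) 0) := by
  intro y
  set M := Finset.univ.sup' (Finset.univ_nonempty_iff.mpr ⟨⟨0, hk⟩⟩) fun i => max (g i y) 0
  have hle : ∀ i, max (g i y) 0 ≤ M := fun i =>
    Finset.le_sup' (fun i => max (g i y) 0) (Finset.mem_univ i)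
  have hM0 : 0 ≤ M := (le_max_right _ _).trans (hle ⟨0, hk⟩)
  have hpos : 0 < ρ + M := by positivity
  set z : Fin n → ℝ := (ρ / (ρ + M)) • y + (M / (ρ + M)) • xbar with hz
  have hzX : z ∈ X := by
    rw [hX]
    intro i
    calc g i z ≤ (ρ / (ρ + M)) • g i y + (M / (ρ + M)) • g i xbar :=
          (hconv i).2 (Set.mem_univ y) (Set.mem_univ xbar) (by positivity) (by positivity)
            (by field_simp)
      _ ≤ (ρ / (ρ + M)) • M + (M / (ρ + M)) • (-ρ) := by
          gcongr
          · exact (le_max_left _ _).trans (hle i)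
          · exact hslater i
      _ = 0 := by
          simp only [smul_eq_mul]
          ring
  have hyz : y - z = (M / ρ) • (z - xbar) := by
    ext j
    simp only [hz, Pi.sub_apply, Pi.add_apply, Pi.smul_apply, smul_eq_mul]
    field_simp
    ring
  calc Metric.infDist y X ≤ dist y z := Metric.infDist_le_dist_of_mem hzX
    _ = (M / ρ) * ‖z - xbar‖ := by
        rw [dist_eq_norm, hyz, norm_smul, Real.norm_of_nonneg (by positivity)]
    _ ≤ (M / ρ) * A := by
        gcongr
        exact hdiam z hzX xbar hxbarX
    _ = (A / ρ) * M := by ring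
end

section
/- Let X ⊆ ℝ^n be a compact convex set, F : ℝ^n → ℝ a continuous convex function, X* the (convex, closed) set of minimizers of F over X and ϑ := min_X F. For ε > 0 with X \ (X* + εB) nonempty (B the open unit ball), define a(ε) := min{F(x) : x ∈ X, dist(x, X*) ≥ ε} − ϑ. Then a is strictly increasing: for all 0 < ε₁ < ε₂ with {x ∈ X : dist(x, X*) ≥ ε₂} nonempty, a(ε₁) < a(ε₂). -/
/-- **Strict monotonicity of the optimality-gap function.**
Let `X ⊆ ℝ^n` (ℓ∞ norm) be compact convex, `F` continuous and convex, `X*` the set of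
minimizers of `F` over `X` and `ϑ = min_X F`.  For `ε > 0` let
`a(ε) = min {F x : x ∈ X, dist(x, X*) ≥ ε} − ϑ`.  Then `a` is strictly increasing:
for `0 < ε₁ < ε₂` with `{x ∈ X : dist(x, X*) ≥ ε₂}` nonempty, `a(ε₁) < a(ε₂)`. -/
theorem optimality_gap_strict_mono {n : ℕ}
    (X : Set (Fin n → ℝ)) (hXcompact : IsCompact X) (hXconv : Convex ℝ X)
    (hXne : X.Nonempty)
    (F : (Fin n → ℝ) → ℝ) (hFcont : Continuous F) (hFconv : ConvexOn ℝ X F)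
    (Xstar : Set (Fin n → ℝ)) (hXstar : Xstar = {x ∈ X | ∀ y ∈ X, F x ≤ F y})
    (ϑ : ℝ) (hϑ : IsLeast (F '' X) ϑ)
    (a : ℝ → ℝ)
    (ha : ∀ ε : ℝ,
      a ε = sInf {c | ∃ x ∈ X, ε ≤ Metric.infDist x Xstar ∧ c = F x} - ϑ) :
    ∀ ε₁ ε₂ : ℝ, 0 < ε₁ → ε₁ < ε₂ →
      {x ∈ X | ε₂ ≤ Metric.infDist x Xstar}.Nonempty → a ε₁ < a ε₂ := by
  intro ε₁ ε₂ hε₁ hε hne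
  obtain ⟨⟨z, hzX, rfl⟩, hlb⟩ := hϑ
  have hzmin : ∀ y ∈ X, F z ≤ F y := fun y hy => hlb ⟨y, hy, rfl⟩
  have hz : z ∈ Xstar := hXstar ▸ ⟨hzX, hzmin⟩
  have hcompact : IsCompact {x ∈ X | ε₂ ≤ Metric.infDist x Xstar} :=
    hXcompact.inter_right (isClosed_le continuous_const (Metric.continuous_infDist_pt Xstar))
  obtain ⟨x, ⟨hxX, hxdist⟩, hxmin⟩ := hcompact.exists_isMinOn hne hFcont.continuousOn
  have hFzx : F z < F x := by
    by_contra! hle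
    have hx : x ∈ Xstar := hXstar ▸ ⟨hxX, fun y hy => hle.trans (hzmin y hy)⟩
    linarith [Metric.infDist_zero_of_mem hx]
  -- Moving from `x` towards `z` by the fraction `s` changes the distance by at most `ε₂ - ε₁`.
  set D := dist z x
  have hD : 0 ≤ D := dist_nonneg
  have hden : 0 < D + ε₂ := by linarith
  set s := (ε₂ - ε₁) / (D + ε₂)
  have hs0 : 0 < s := div_pos (by linarith) hden
  have hs1 : s ≤ 1 := (div_le_one hden).2 (by linarith)
  have hsD : s * D ≤ ε₂ - ε₁ := by
    have : s * (D + ε₂) = ε₂ - ε₁ := div_mul_cancel₀ _ hden.ne'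
    nlinarith
  set y := AffineMap.lineMap x z s
  have hyeq : y = (1 - s) • x + s • z := AffineMap.lineMap_apply_module x z s
  have hyX : y ∈ X :=
    hyeq ▸ hXconv hxX hzX (by linarith) hs0.le (by ring)
  have hydist : ε₁ ≤ Metric.infDist y Xstar := by
    have hxy : dist x y = s * D := by
      rw [dist_left_lineMap, Real.norm_of_nonneg hs0.le, dist_comm x z]
    linarith [Metric.infDist_le_infDist_add_dist (s := Xstar) (x := x) (y := y)]
  have hFy : F y < F x := by
    have h := hFconv.2 hxX hzX (by linarith : 0 ≤ 1 - s) hs0.le (by ring)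
    rw [← hyeq, smul_eq_mul, smul_eq_mul] at h
    nlinarith
  rw [ha, ha]
  refine sub_lt_sub_right ?_ _
  calc sInf {c | ∃ x ∈ X, ε₁ ≤ Metric.infDist x Xstar ∧ c = F x}
      ≤ F y := csInf_le ⟨F z, by rintro _ ⟨w, hw, -, rfl⟩; exact hzmin w hw⟩
        ⟨y, hyX, hydist, rfl⟩
    _ < F x := hFy
    _ ≤ sInf {c | ∃ x ∈ X, ε₂ ≤ Metric.infDist x Xstar ∧ c = F x} :=
      le_csInf ⟨F x, x, hxX, hxdist, rfl⟩ (by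
        rintro _ ⟨w, hw, hwdist, rfl⟩
        exact hxmin ⟨hw, hwdist⟩)
end

section
/- Let f(x) := (1/2)·∫_0^2 |x − t| dt and, for δ > 0, f_δ(x) := (1/(2+δ))·∫_{−δ}^2 |x − t| dt. Then for every x ∈ [0, 2], f(x) = ((x−1)² + 1)/2 and f_δ(x) = ((x+δ)² + (2−x)²)/(2(2+δ)); the set of maximizers of f over [0, 2] equals {0, 2}, while for every δ > 0 the set of maximizers of f_δ over [0, 2] equals {2}; consequently the Hausdorff distance between these two maximizer sets equals 2 for every δ > 0. -/
open MeasureTheory intervalIntegral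

/-- The integral of the distance to an interior point of an interval. -/
lemma integral_abs_sub_left {a b x : ℝ} (hax : a ≤ x) (hxb : x ≤ b) :
    ∫ t in a..b, |x - t| = ((x - a) ^ 2 + (b - x) ^ 2) / 2 := by
  have hint (c d : ℝ) : IntervalIntegrable (fun t => |x - t|) volume c d :=
    Continuous.intervalIntegrable (by fun_prop) c d
  have hleft : ∫ t in a..x, |x - t| = ∫ t in a..x, (x - t) := by
    refine integral_congr fun t ht => ?_
    rw [Set.uIcc_of_le hax] at ht
    exact abs_of_nonneg (sub_nonneg.2 ht.2)
  have hright : ∫ t in x..b, |x - t| = ∫ t in x..b, (t - x) := by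
    refine integral_congr fun t ht => ?_
    rw [Set.uIcc_of_le hxb] at ht
    exact (abs_sub_comm x t).trans (abs_of_nonneg (sub_nonneg.2 ht.1))
  rw [← integral_add_adjacent_intervals (hint a x) (hint x b), hleft, hright,
    intervalIntegral.integral_sub (by simp) (by simp),
    intervalIntegral.integral_sub (by simp) (by simp)]
  simp only [intervalIntegral.integral_const, integral_id, smul_eq_mul]
  ring

/-- The Hausdorff distance between a pair of points and one of them. -/
lemma hausdorffDist_pair_singleton {α : Type*} [PseudoMetricSpace α] (x y : α) :
    Metric.hausdorffDist {x, y} {y} = dist x y := by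
  apply le_antisymm
  · refine Metric.hausdorffDist_le_of_mem_dist dist_nonneg ?_ ?_
    · rintro z (rfl | rfl)
      · exact ⟨y, rfl, le_rfl⟩
      · exact ⟨z, rfl, by simp⟩
    · rintro z rfl
      exact ⟨z, by simp, by simp⟩
  · rw [← Metric.infDist_singleton]
    exact Metric.infDist_le_hausdorffDist_of_mem (by simp)
      (Metric.hausdorffEDist_ne_top_of_nonempty_of_bounded (by simp) (by simp)
        ((Set.toFinite _).isBounded) ((Set.toFinite _).isBounded))

/-- **Discontinuity of the optimal-solution set without convexity.**
With `f(x) = (1/2)∫₀² |x − t| dt` (the expectation of `|x − ξ|` for `ξ ~ U(0,2)`) and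
`f_δ(x) = (1/(2+δ))∫_{−δ}² |x − t| dt` (for `ξ̃ ~ U(−δ,2)`): on `[0,2]` one has
`f(x) = ((x−1)² + 1)/2` and `f_δ(x) = ((x+δ)² + (2−x)²)/(2(2+δ))`; the maximizers of `f`
on `[0,2]` are exactly `{0, 2}`, while for every `δ > 0` the maximizers of `f_δ` on `[0,2]`
are exactly `{2}`; consequently the Hausdorff distance between the two maximizer sets is `2`. -/
theorem argmax_set_discontinuous_example :
    (∀ x ∈ Set.Icc (0 : ℝ) 2,
      (1 / 2) * ∫ t in (0 : ℝ)..2, |x - t| = ((x - 1) ^ 2 + 1) / 2) ∧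
    (∀ δ : ℝ, 0 < δ → ∀ x ∈ Set.Icc (0 : ℝ) 2,
      (1 / (2 + δ)) * ∫ t in (-δ : ℝ)..2, |x - t| =
        ((x + δ) ^ 2 + (2 - x) ^ 2) / (2 * (2 + δ))) ∧
    ({x ∈ Set.Icc (0 : ℝ) 2 | ∀ y ∈ Set.Icc (0 : ℝ) 2,
        (1 / 2) * ∫ t in (0 : ℝ)..2, |y - t| ≤ (1 / 2) * ∫ t in (0 : ℝ)..2, |x - t|}
      = {0, 2}) ∧
    (∀ δ : ℝ, 0 < δ →
      {x ∈ Set.Icc (0 : ℝ) 2 | ∀ y ∈ Set.Icc (0 : ℝ) 2,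
          (1 / (2 + δ)) * ∫ t in (-δ : ℝ)..2, |y - t| ≤
            (1 / (2 + δ)) * ∫ t in (-δ : ℝ)..2, |x - t|}
        = {2}) ∧
    (∀ δ : ℝ, 0 < δ → Metric.hausdorffDist ({0, 2} : Set ℝ) ({2} : Set ℝ) = 2) := by
  have hf : ∀ x ∈ Set.Icc (0 : ℝ) 2,
      (1 / 2) * ∫ t in (0 : ℝ)..2, |x - t| = ((x - 1) ^ 2 + 1) / 2 := by
    intro x hx
    rw [integral_abs_sub_left hx.1 hx.2]
    ring
  have hfδ : ∀ δ : ℝ, 0 < δ → ∀ x ∈ Set.Icc (0 : ℝ) 2,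
      (1 / (2 + δ)) * ∫ t in (-δ : ℝ)..2, |x - t| =
        ((x + δ) ^ 2 + (2 - x) ^ 2) / (2 * (2 + δ)) := by
    intro δ hδ x hx
    rw [integral_abs_sub_left (by linarith [hx.1]) hx.2]
    field_simp
    ring
  have h2 : (2 : ℝ) ∈ Set.Icc (0 : ℝ) 2 := by simp
  refine ⟨hf, hfδ, ?_, fun δ hδ => ?_, fun δ _ => ?_⟩
  · ext x
    constructor
    · rintro ⟨hx, hmax⟩
      have h := hmax 2 h2
      rw [hf 2 h2, hf x hx] at h
      have hprod : x * (x - 2) = 0 :=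
        le_antisymm (mul_nonpos_of_nonneg_of_nonpos hx.1 (sub_nonpos.2 hx.2)) (by linarith)
      rcases mul_eq_zero.1 hprod with h | h
      · exact Or.inl h
      · exact Or.inr (sub_eq_zero.1 h)
    · intro hx
      have hxI : x ∈ Set.Icc (0 : ℝ) 2 := by
        rcases hx with rfl | rfl <;> simp
      refine ⟨hxI, fun y hy => ?_⟩
      rw [hf y hy, hf x hxI]
      have hprod := mul_nonneg hy.1 (sub_nonneg.2 hy.2)
      rcases hx with rfl | rfl <;> linarith
  · ext x
    constructor
    · rintro ⟨hx, hmax⟩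
      have h := hmax 2 h2
      rw [hfδ δ hδ 2 h2, hfδ δ hδ x hx, div_le_div_iff_of_pos_right (by positivity)] at h
      have hpos : 0 < x + δ := by linarith [hx.1]
      have hle : 2 - x ≤ 0 := nonpos_of_mul_nonpos_right (by linarith) hpos
      exact le_antisymm hx.2 (by linarith)
    · rintro rfl
      refine ⟨h2, fun y hy => ?_⟩
      rw [hfδ δ hδ y hy, hfδ δ hδ 2 h2, div_le_div_iff_of_pos_right (by positivity)]
      have hprod := mul_nonneg (show 0 ≤ y + δ by linarith [hy.1]) (sub_nonneg.2 hy.2)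
      linarith
  · simp [hausdorffDist_pair_singleton]
end
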